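/- Let p be a prime number, let K be a p-adic field (a finite-dimensional field extension of ℚ_p), let d be a prime number, and let n be a natural number with n ≥ d^2. Let f be a homogeneous polynomial of degree d in n+1 variables with coefficients in K. Then the hypersurface {f = 0} carries a 0-cycle of degree 1: there exist finitely many finite field extensions L_1, …, L_r of K such that f has a nontrivial zero in L_j^{n+1} for each j, and the greatest common divisor of the degrees [L_1 : K], …, [L_r : K] equals 1. -/

import Mathlib

open MvPolynomial

universe u

lemma eval_map_comp {R S σ : Type*} [CommSemiring R] [CommSemiring S] (φ : R →+* S) (a : σ → R)
    (p : MvPolynomial σ R) : eval (fun i => φ (a i)) (map φ p) = φ (eval a p) := by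
  rw [eval_map, eval₂_comp]
  rfl

lemma eval_smul_of_isHomogeneous {K σ : Type*} [Field K] {d : ℕ} {f : MvPolynomial σ K}
    (hf : f.IsHomogeneous d) (a : K) (x : σ → K) : eval (a • x) f = a ^ d * eval x f := by
  rw [eval_eq, eval_eq, Finset.mul_sum]
  refine Finset.sum_congr rfl fun s hs => ?_
  rw [hf.degree_eq_sum_deg_support hs, ← Finset.prod_pow_eq_pow_sum, mul_left_comm,
    ← Finset.prod_mul_distrib]
  simp [mul_pow]

section Lattice

variable {O K : Type*} [CommRing O] [IsDomain O] [IsDiscreteValuationRing O] [Field K]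
  [Algebra O K] [IsFractionRing O K]

/-- A form taking integral values at integral points has integral coefficients, provided the
residue field has at least as many elements as the degree. -/
lemma exists_map_eq_of_eval_integral {τ : Type*} [Finite τ] {d : ℕ}
    (hq : d ≤ Cardinal.mk (IsLocalRing.ResidueField O)) {G : MvPolynomial τ K}
    (hG : G.IsHomogeneous d)
    (h : ∀ a : τ → O, ∃ o : O, algebraMap O K o = eval (fun i => algebraMap O K (a i)) G) :
    ∃ H : MvPolynomial τ O, map (algebraMap O K) H = G := by
  have hinj : Function.Injective (algebraMap O K) := IsFractionRing.injective O K
  obtain ⟨π, hπ⟩ := IsDiscreteValuationRing.exists_irreducible O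
  have clear_pow : ∀ (k : ℕ) (H : MvPolynomial τ O),
      map (algebraMap O K) H = C (algebraMap O K (π ^ k)) * G →
      ∃ H : MvPolynomial τ O, map (algebraMap O K) H = G := by
    intro k
    induction k with
    | zero => intro H hH; exact ⟨H, by simpa using hH⟩
    | succ k ih =>
      intro H hH
      have hHhom : H.IsHomogeneous d := .of_map hinj (hH ▸ hG.C_mul _)
      have hred : map (IsLocalRing.residue O) H = 0 := by
        refine (hHhom.map _).eq_zero_of_forall_eval_eq_zero_of_le_card (fun r => ?_) hq
        choose a ha using fun i => IsLocalRing.residue_surjective (r i)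
        obtain rfl : (fun i => IsLocalRing.residue O (a i)) = r := funext ha
        obtain ⟨o, ho⟩ := h a
        have : eval a H = π ^ (k + 1) * o := by
          apply hinj
          have := congrArg (eval (fun i => algebraMap O K (a i))) hH
          rw [eval_map_comp] at this
          rw [this, map_mul (algebraMap O K), ho, map_mul (eval _), eval_C]
        rw [eval_map_comp, this, IsLocalRing.residue_eq_zero_iff, pow_succ', mul_assoc]
        exact Ideal.mul_mem_right _ _ ((IsLocalRing.mem_maximalIdeal _).2 hπ.not_isUnit)
      obtain ⟨H', rfl⟩ := (C_dvd_iff_map_hom_eq_zero (IsLocalRing.residue O) π (fun r => by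
        rw [IsLocalRing.residue_eq_zero_iff, hπ.maximalIdeal_eq, Ideal.mem_span_singleton]) H).2
        hred
      refine ih H' ?_
      have h0 : (C (algebraMap O K π) : MvPolynomial τ K) ≠ 0 := by
        simpa using hπ.ne_zero
      apply mul_left_cancel₀ h0
      rw [map_mul, map_C] at hH
      rw [hH, pow_succ', map_mul, C_mul, mul_assoc]
  obtain ⟨b, hb⟩ := IsLocalization.exist_integer_multiples (nonZeroDivisors O) G.support
    (fun s => coeff s G)
  have hb0 : (b : O) ≠ 0 := nonZeroDivisors.ne_zero b.2
  obtain ⟨k, hk⟩ := IsDiscreteValuationRing.associated_pow_irreducible hb0 hπ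
  obtain ⟨u, hu⟩ := hk
  have hmem : C (algebraMap O K (b : O)) * G ∈ Set.range (map (σ := τ) (algebraMap O K)) := by
    rw [mem_range_map_iff_coeffs_subset]
    intro c hc
    obtain ⟨s, hs, rfl⟩ := mem_coeffs_iff.1 hc
    obtain ⟨o, ho⟩ := hb s (by
      rw [mem_support_iff, coeff_C_mul] at *
      exact right_ne_zero_of_mul hs)
    refine ⟨o, ?_⟩
    rw [ho, coeff_C_mul, Algebra.smul_def]
  obtain ⟨H, hH⟩ := hmem
  refine clear_pow k (C (u : O) * H) ?_
  rw [map_mul, hH, ← hu, map_C, ← mul_assoc, ← C_mul, ← map_mul, mul_comm (u : O)]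

/-- Vectors at which `f` takes a value divisible by `z`. -/
def IsDivisibleAt (O : Type*) {K σ : Type*} [CommRing O] [Field K] [Algebra O K]
    (f : MvPolynomial σ K) (z : O) (x : σ → K) : Prop :=
  ∃ o : O, algebraMap O K (z * o) = eval x f

/-- The `O`-submodule of vectors at which `f` takes a value divisible by `z`. -/
def divisibleSubmodule {σ : Type*} {d : ℕ} (hd : d ≠ 0) {f : MvPolynomial σ K}
    (hf : f.IsHomogeneous d)
    (hadd : ∀ (z : O) (x y : σ → K), IsDivisibleAt O f z x → IsDivisibleAt O f z y →
      IsDivisibleAt O f z (x + y)) (z : O) : Submodule O (σ → K) where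
  carrier := {x | IsDivisibleAt O f z x}
  add_mem' := hadd z _ _
  zero_mem' := ⟨0, by
    have := eval_smul_of_isHomogeneous hf 0 0
    rw [zero_smul, zero_pow hd, zero_mul] at this
    rw [this, mul_zero, map_zero]⟩
  smul_mem' a x := by
    rintro ⟨o, ho⟩
    refine ⟨a ^ d * o, ?_⟩
    rw [← algebraMap_smul K a x, eval_smul_of_isHomogeneous hf, ← ho]
    simp only [map_mul, map_pow]
    ring

/-- Over a finite field a form in more variables than its degree is isotropic. -/
lemma exists_ne_zero_eval_eq_zero {k : Type*} [Field k] [Finite k] {d : ℕ} (hd : d ≠ 0)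
    {f : MvPolynomial (Fin (d + 1)) k} (hf : f.IsHomogeneous d) :
    ∃ x : Fin (d + 1) → k, x ≠ 0 ∧ eval x f = 0 := by
  classical
  have := Fintype.ofFinite k
  obtain ⟨p, hp⟩ := CharP.exists k
  have hprime : Fact p.Prime := ⟨CharP.char_is_prime k p⟩
  have hdvd := char_dvd_card_solutions p (f := f)
    (by simpa using Nat.lt_succ_of_le hf.totalDegree_le)
  have h0 : eval 0 f = 0 := by
    have := eval_smul_of_isHomogeneous hf 0 0
    rwa [zero_smul, zero_pow hd, zero_mul] at this
  have hpos : 0 < Fintype.card {x : Fin (d + 1) → k // eval x f = 0} :=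
    Fintype.card_pos_iff.2 ⟨⟨0, h0⟩⟩
  obtain ⟨y, hy⟩ := Fintype.exists_ne_of_one_lt_card
    (hprime.out.one_lt.trans_le (Nat.le_of_dvd hpos hdvd)) ⟨0, h0⟩
  exact ⟨y, fun h => hy (Subtype.ext h), y.2⟩

/-- Among `d + 1` vectors of `M`, some combination with not all coefficients in the maximal ideal
makes `f` more divisible. -/
lemma exists_sum_smul_isDivisibleAt [Finite (IsLocalRing.ResidueField O)] {σ : Type*} {d : ℕ}
    (hd : d ≠ 0) (hq : d ≤ Cardinal.mk (IsLocalRing.ResidueField O)) {f : MvPolynomial σ K}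
    (hf : f.IsHomogeneous d)
    (hadd : ∀ (z : O) (x y : σ → K), IsDivisibleAt O f z x → IsDivisibleAt O f z y →
      IsDivisibleAt O f z (x + y)) {π : O} (hπ : Irreducible π) {z : O} (hz : z ≠ 0)
    (e : Fin (d + 1) → σ → K) (he : ∀ i, IsDivisibleAt O f z (e i)) :
    ∃ a : Fin (d + 1) → O, IsDivisibleAt O f (z * π) (∑ i, a i • e i) ∧
      ∃ i, a i ∉ IsLocalRing.maximalIdeal O := by
  set F : MvPolynomial (Fin (d + 1)) K := aeval (fun j => ∑ i, C (e i j) * X i) f with hF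
  have hFhom : F.IsHomogeneous d := by
    have := hf.aeval (fun j => ∑ i : Fin (d + 1), C (e i j) * X i) (n := 1) fun j =>
      IsHomogeneous.sum _ _ _ fun i _ => isHomogeneous_C_mul_X _ _
    rwa [one_mul] at this
  have hFeval : ∀ a : Fin (d + 1) → O,
      eval (fun i => algebraMap O K (a i)) F = eval (∑ i, a i • e i) f := by
    intro a
    rw [hF, ← coe_aeval_eq_eval, ← coe_aeval_eq_eval]
    change ((aeval fun i => algebraMap O K (a i)).comp (aeval _)) f = aeval _ f
    rw [comp_aeval]
    congr 2
    ext j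
    simp [Algebra.smul_def, mul_comm]
  have hzK : algebraMap O K z ≠ 0 := by simpa using hz
  obtain ⟨H, hH⟩ := exists_map_eq_of_eval_integral hq (hFhom.C_mul (algebraMap O K z)⁻¹) (by
    intro a
    obtain ⟨o, ho⟩ := (divisibleSubmodule hd hf hadd z).sum_mem (t := Finset.univ)
      (f := fun i => a i • e i) fun i _ => Submodule.smul_mem _ _ (he i)
    refine ⟨o, ?_⟩
    rw [map_mul, eval_C, hFeval, ← ho, map_mul, inv_mul_cancel_left₀ hzK])
  have hHhom : H.IsHomogeneous d :=
    .of_map (IsFractionRing.injective O K) (hH ▸ hFhom.C_mul _)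
  obtain ⟨r, hr0, hr⟩ := exists_ne_zero_eval_eq_zero hd (hHhom.map (IsLocalRing.residue O))
  choose a ha using fun i => IsLocalRing.residue_surjective (r i)
  obtain rfl : (fun i => IsLocalRing.residue O (a i)) = r := funext ha
  refine ⟨a, ?_, ?_⟩
  · rw [eval_map_comp, IsLocalRing.residue_eq_zero_iff, hπ.maximalIdeal_eq,
      Ideal.mem_span_singleton] at hr
    obtain ⟨o, ho⟩ := hr
    refine ⟨o, ?_⟩
    have := congrArg (eval (fun i => algebraMap O K (a i))) hH
    rw [eval_map_comp, ho, map_mul (algebraMap O K), map_mul (eval _), eval_C, hFeval] at this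
    rw [mul_assoc, map_mul, map_mul _ π o, this, mul_inv_cancel_left₀ hzK]
  · by_contra! hall
    exact hr0 (funext fun i => (IsLocalRing.residue_eq_zero_iff _).2 (hall i))

/-- Greedy choice of generators of `M` modulo `N`. -/
lemma exists_le_span_sup {V : Type*} [AddCommGroup V] [Module O V] (M N : Submodule O V)
    (hMN : ∀ r ∈ IsLocalRing.maximalIdeal O, ∀ x ∈ M, r • x ∈ N) (d : ℕ)
    (h : ∀ e : Fin (d + 1) → V, (∀ i, e i ∈ M) →
      ∃ a : Fin (d + 1) → O, ∑ i, a i • e i ∈ N ∧ ∃ i, a i ∉ IsLocalRing.maximalIdeal O) :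
    ∃ S : Set V, S.Finite ∧ S.ncard ≤ d ∧ M ≤ Submodule.span O S ⊔ N := by
  set P : ℕ → Prop := fun s => ∃ e : Fin s → V, (∀ i, e i ∈ M) ∧
    ∀ a : Fin s → O, ∑ i, a i • e i ∈ N → ∀ i, a i ∈ IsLocalRing.maximalIdeal O with hP
  have h0 : P 0 := ⟨Fin.elim0, fun i => i.elim0, fun _ _ i => i.elim0⟩
  have hd : ¬ P (d + 1) := by
    rintro ⟨e, he, hind⟩
    obtain ⟨a, ha, i, hi⟩ := h e he
    exact hi (hind a ha i)
  obtain ⟨s, hsd, ⟨e, he, hind⟩, hs⟩ : ∃ s ≤ d, P s ∧ ¬ P (s + 1) := by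
    by_contra! hcon
    have : ∀ s ≤ d + 1, P s := by
      intro s
      induction s with
      | zero => exact fun _ => h0
      | succ s ih => exact fun hs => hcon s (by omega) (ih (by omega))
    exact hd (this _ le_rfl)
  refine ⟨Set.range e, Set.finite_range e, ?_, fun x hx => ?_⟩
  · refine le_trans ?_ hsd
    rw [← Set.image_univ]
    exact (Set.ncard_image_le).trans (by simp)
  · simp only [hP, not_exists, not_and, not_forall] at hs
    obtain ⟨a, ha, i, hi⟩ := hs (Fin.cons x e) (fun i => by
      refine Fin.cases ?_ (fun i => ?_) i
      · simpa using hx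
      · simpa using he i)
    rw [Fin.sum_univ_succ] at ha
    simp only [Fin.cons_zero, Fin.cons_succ] at ha
    have ha0 : IsUnit (a 0) := by
      by_contra hnu
      have hm : a 0 ∈ IsLocalRing.maximalIdeal O := (IsLocalRing.mem_maximalIdeal _).2 hnu
      have := hind _ ((N.add_mem_iff_right (hMN _ hm x hx)).1 ha)
      exact hi (Fin.cases hm this i)
    obtain ⟨u, hu⟩ := ha0
    have hsum : ∑ i : Fin s, a i.succ • e i ∈ Submodule.span O (Set.range e) :=
      Submodule.sum_mem _ fun i _ =>
        Submodule.smul_mem _ _ (Submodule.subset_span (Set.mem_range_self i))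
    have hux : a 0 • x ∈ Submodule.span O (Set.range e) ⊔ N := by
      rw [← add_sub_cancel_right (a 0 • x) (∑ i : Fin s, a i.succ • e i)]
      exact Submodule.sub_mem _ (Submodule.mem_sup_right ha) (Submodule.mem_sup_left hsum)
    have := Submodule.smul_mem _ (↑u⁻¹ : O) hux
    rwa [smul_smul, ← hu, Units.inv_mul, one_smul] at this

/-- The dimension bound. -/
theorem card_le_sq_of_isDivisibleAt_add [Finite (IsLocalRing.ResidueField O)] {σ : Type*}
    [Fintype σ] {d : ℕ}
    (hd : d ≠ 0) (hq : d ≤ Cardinal.mk (IsLocalRing.ResidueField O)) {f : MvPolynomial σ K}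
    (hf : f.IsHomogeneous d)
    (hadd : ∀ (z : O) (x y : σ → K), IsDivisibleAt O f z x → IsDivisibleAt O f z y →
      IsDivisibleAt O f z (x + y))
    (hbdd : ∃ c : O, c ≠ 0 ∧ ∀ x : σ → K, IsDivisibleAt O f 1 x →
      ∀ i, ∃ o : O, algebraMap O K o = c • x i) :
    Fintype.card σ ≤ d ^ 2 := by
  classical
  obtain ⟨π, hπ⟩ := IsDiscreteValuationRing.exists_irreducible O
  set L : ℕ → Submodule O (σ → K) := fun i => divisibleSubmodule hd hf hadd (π ^ i) with hL
  have hstep : ∀ i, ∃ S : Set (σ → K), S.Finite ∧ S.ncard ≤ d ∧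
      L i ≤ Submodule.span O S ⊔ L (i + 1) := by
    intro i
    refine exists_le_span_sup _ _ (fun r hr x hx => ?_) d fun e he => ?_
    · rw [hπ.maximalIdeal_eq, Ideal.mem_span_singleton] at hr
      obtain ⟨s, rfl⟩ := hr
      obtain ⟨o, ho⟩ := hx
      obtain ⟨k, rfl⟩ := Nat.exists_eq_add_one_of_ne_zero hd
      refine ⟨π ^ k * s ^ (k + 1) * o, ?_⟩
      rw [← algebraMap_smul K (π * s) x, eval_smul_of_isHomogeneous hf, ← ho]
      simp only [map_mul, map_pow]
      ring
    · have := exists_sum_smul_isDivisibleAt hd hq hf hadd hπ (pow_ne_zero i hπ.ne_zero) e he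
      rwa [← pow_succ] at this
  choose S hSfin hScard hS using hstep
  have hchain : ∀ k, L 0 ≤ Submodule.span O (⋃ i ∈ Finset.range k, S i) ⊔ L k := by
    intro k
    induction k with
    | zero => exact le_sup_right
    | succ k ih =>
      refine ih.trans (sup_le ?_ ((hS k).trans ?_))
      · exact le_sup_of_le_left (Submodule.span_mono
          (Set.biUnion_subset_biUnion_left (by intro i; simp; omega)))
      · refine sup_le_sup_right (Submodule.span_mono ?_) _
        exact Set.subset_biUnion_of_mem (u := S) (by simp)
  have hLd : L d ≤ IsLocalRing.maximalIdeal O • L 0 := by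
    rintro x ⟨o, ho⟩
    have hπK : algebraMap O K π ≠ 0 := by simpa using hπ.ne_zero
    have hx : x = π • ((algebraMap O K π)⁻¹ • x) := by
      rw [← algebraMap_smul K π, smul_inv_smul₀ hπK]
    rw [hx]
    refine Submodule.smul_mem_smul ((IsLocalRing.mem_maximalIdeal _).2 hπ.not_isUnit) ⟨o, ?_⟩
    rw [eval_smul_of_isHomogeneous hf, ← ho, map_mul, map_mul, map_pow, map_pow, inv_pow,
      inv_mul_cancel_left₀ (pow_ne_zero _ hπK), pow_zero, one_mul]
  obtain ⟨c, hc0, hc⟩ := hbdd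
  have hcK : algebraMap O K c ≠ 0 := by simpa using hc0
  have hfg : (L 0).FG := by
    let φ : (σ → O) →ₗ[O] (σ → K) :=
      { toFun := fun a i => (algebraMap O K c)⁻¹ * algebraMap O K (a i)
        map_add' := fun a b => by ext i; simp [mul_add]
        map_smul' := fun r a => by ext i; simp [Algebra.smul_def]; ring }
    have hle : L 0 ≤ LinearMap.range φ := by
      intro x hx
      choose a ha using hc x (pow_zero π ▸ hx)
      refine ⟨a, funext fun i => ?_⟩
      change (algebraMap O K c)⁻¹ * algebraMap O K (a i) = x i
      rw [ha, Algebra.smul_def, inv_mul_cancel_left₀ hcK]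
    exact isNoetherian_submodule.1 (isNoetherian_range φ) _ hle
  set T : Set (σ → K) := ⋃ i ∈ Finset.range d, S i with hT
  have hTfin : T.Finite := Set.Finite.biUnion (Finset.finite_toSet _) fun i _ => hSfin i
  have hTcard : T.ncard ≤ d ^ 2 := by
    refine (Finset.set_ncard_biUnion_le _ _).trans ((Finset.sum_le_sum fun i _ => hScard i).trans ?_)
    simp [sq]
  have hspan : L 0 ≤ Submodule.span O T := by
    refine Submodule.le_of_le_smul_of_le_jacobson_bot hfg
      (IsLocalRing.maximalIdeal_le_jacobson _) ((hchain d).trans (sup_le_sup_left hLd _))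
  have htop : Submodule.span K T = ⊤ := by
    rw [eq_top_iff]
    rintro x -
    obtain ⟨b, o, ho, hbo⟩ := IsFractionRing.div_surjective (A := O) (eval x f)
    have ho0 : algebraMap O K o ≠ 0 := by simpa using nonZeroDivisors.ne_zero ho
    have hmem : (algebraMap O K o) • x ∈ L 0 := by
      obtain ⟨k, rfl⟩ := Nat.exists_eq_add_one_of_ne_zero hd
      refine ⟨o ^ k * b, ?_⟩
      rw [eval_smul_of_isHomogeneous hf, ← hbo]
      simp only [map_mul, map_pow, pow_zero, one_mul]
      field_simp
      ring
    have := Submodule.span_subset_span O K T (hspan hmem)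
    have := Submodule.smul_mem _ (algebraMap O K o)⁻¹ this
    rwa [inv_smul_smul₀ ho0] at this
  calc Fintype.card σ = Module.finrank K (σ → K) := by simp
    _ = Module.finrank K (Submodule.span K T) := by rw [htop, finrank_top]
    _ ≤ T.ncard := by
      have := hTfin.fintype
      rw [Set.ncard_eq_toFinset_card']
      exact finrank_span_le_card T
    _ ≤ d ^ 2 := hTcard

end Lattice

section Line

variable {K : Type u} [Field K] {σ : Type*}

/-- The restriction `f (x + t y)` of `f` to a line, as a polynomial in `t`. -/
noncomputable def linePoly (f : MvPolynomial σ K) (x y : σ → K) : Polynomial K :=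
  aeval (fun j => Polynomial.C (x j) + Polynomial.C (y j) * Polynomial.X) f

lemma aeval_linePoly (f : MvPolynomial σ K) (x y : σ → K) {L : Type*} [Field L] [Algebra K L]
    (t : L) : Polynomial.aeval t (linePoly f x y) =
      aeval (fun j => algebraMap K L (x j) + algebraMap K L (y j) * t) f := by
  change ((Polynomial.aeval t).comp (aeval _)) f = _
  rw [comp_aeval]
  simp

lemma eval_linePoly (f : MvPolynomial σ K) (x y : σ → K) (t : K) :
    (linePoly f x y).eval t = eval (x + t • y) f := by
  have hxy : (fun j => algebraMap K K (x j) + algebraMap K K (y j) * t) = x + t • y := by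
    ext j
    simp [mul_comm]
  rw [← Polynomial.coe_aeval_eq_eval, aeval_linePoly, hxy, aeval_eq_eval]

lemma natDegree_linePoly_le_and_coeff {d : ℕ} {f : MvPolynomial σ K} (hf : f.IsHomogeneous d)
    (x y : σ → K) : (linePoly f x y).natDegree ≤ d ∧ (linePoly f x y).coeff d = eval y f := by
  have key : ∀ (s : σ →₀ ℕ) (t : Finset σ),
      (∏ i ∈ t, (Polynomial.C (x i) + Polynomial.C (y i) * Polynomial.X) ^ s i).natDegree ≤
        ∑ i ∈ t, s i ∧
      (∏ i ∈ t, (Polynomial.C (x i) + Polynomial.C (y i) * Polynomial.X) ^ s i).coeff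
        (∑ i ∈ t, s i) = ∏ i ∈ t, y i ^ s i := by
    classical
    intro s t
    induction t using Finset.induction_on with
    | empty => simp
    | insert i t hi ih =>
      rw [Finset.prod_insert hi, Finset.sum_insert hi, Finset.prod_insert hi]
      have h1 : (Polynomial.C (x i) + Polynomial.C (y i) * Polynomial.X).natDegree ≤ 1 := by
        rw [add_comm]
        exact Polynomial.natDegree_linear_le
      have h2 : ((Polynomial.C (x i) + Polynomial.C (y i) * Polynomial.X) ^ s i).natDegree ≤
          s i := by
        simpa using Polynomial.natDegree_pow_le_of_le (s i) h1
      refine ⟨Polynomial.natDegree_mul_le_of_le h2 ih.1, ?_⟩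
      rw [Polynomial.coeff_mul_add_eq_of_natDegree_le h2 ih.1, ih.2]
      have := Polynomial.coeff_pow_of_natDegree_le (m := s i) h1
      rw [mul_one] at this
      rw [this]
      simp
  have hexp : linePoly f x y = ∑ s ∈ f.support, Polynomial.C (coeff s f) *
      ∏ i ∈ s.support, (Polynomial.C (x i) + Polynomial.C (y i) * Polynomial.X) ^ s i := by
    rw [linePoly, aeval_def, eval₂_eq]
    rfl
  constructor
  · rw [hexp]
    refine Polynomial.natDegree_sum_le_of_forall_le _ _ fun s hs => ?_
    rw [hf.degree_eq_sum_deg_support hs]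
    exact (Polynomial.natDegree_C_mul_le _ _).trans (key s _).1
  · rw [hexp, Polynomial.finsetSum_coeff, eval_eq]
    refine Finset.sum_congr rfl fun s hs => ?_
    rw [Polynomial.coeff_C_mul, hf.degree_eq_sum_deg_support hs, (key s _).2]

/-- `f` has no nontrivial zero over a finite extension of degree prime to `d`. -/
def NoCoprimeZero (f : MvPolynomial σ K) (d : ℕ) : Prop :=
  ∀ (L : Type u) [Field L] [Algebra K L] [FiniteDimensional K L],
    (Module.finrank K L).Coprime d → ∀ x : σ → L, aeval x f = 0 → x = 0

lemma NoCoprimeZero.eval_ne_zero {f : MvPolynomial σ K} {d : ℕ} (h : NoCoprimeZero f d)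
    {x : σ → K} (hx : x ≠ 0) : eval x f ≠ 0 := fun h0 =>
  hx (h K (by simp) x (by rw [aeval_eq_eval]; exact h0))

/-- A root of a factor of `f (x + t y)` gives a nontrivial zero of `f`. -/
lemma aeval_ne_zero_of_line {x y : σ → K} (hy : y ≠ 0) (hxy : ∀ c : K, x ≠ c • y)
    {L : Type*} [Field L] [Algebra K L] (t : L) :
    (fun j => algebraMap K L (x j) + algebraMap K L (y j) * t) ≠ 0 := by
  intro h
  obtain ⟨j, hj⟩ := Function.ne_iff.1 hy
  have hj' : algebraMap K L (y j) ≠ 0 := by simpa using hj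
  have ht : t = algebraMap K L (-(x j / y j)) := by
    have := congrFun h j
    simp only [Pi.zero_apply] at this
    rw [map_neg, map_div₀]
    field_simp
    linear_combination this
  refine hxy (x j / y j) (funext fun i => (algebraMap K L).injective ?_)
  have := congrFun h i
  simp only [Pi.zero_apply, ht] at this
  rw [map_neg] at this
  simp only [Pi.smul_apply, smul_eq_mul, map_mul]
  linear_combination this

lemma finrank_adjoinRoot {g : Polynomial K} (hg : Irreducible g) :
    Module.finrank K (AdjoinRoot g) = g.natDegree := by
  rw [(AdjoinRoot.powerBasis hg.ne_zero).finrank, AdjoinRoot.powerBasis_dim]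

lemma aeval_root_eq_zero_of_dvd {g P : Polynomial K} (h : g ∣ P) :
    Polynomial.aeval (AdjoinRoot.root g) P = 0 := by
  rw [AdjoinRoot.aeval_eq, AdjoinRoot.mk_eq_zero]
  exact h

lemma NoCoprimeZero.irreducible_linePoly {d : ℕ} (hd : d.Prime) {f : MvPolynomial σ K}
    (hf : f.IsHomogeneous d) (h : NoCoprimeZero f d) {x y : σ → K} (hy : y ≠ 0)
    (hxy : ∀ c : K, x ≠ c • y) : Irreducible (linePoly f x y) := by
  obtain ⟨hle, hco⟩ := natDegree_linePoly_le_and_coeff hf x y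
  have hc0 : (linePoly f x y).coeff d ≠ 0 := hco ▸ h.eval_ne_zero hy
  have hdeg : (linePoly f x y).natDegree = d :=
    le_antisymm hle (Polynomial.le_natDegree_of_ne_zero hc0)
  have hP0 : linePoly f x y ≠ 0 := fun h0 => hc0 (by simp [h0])
  obtain ⟨g, hg, hgdvd⟩ := Polynomial.exists_irreducible_of_natDegree_pos (hdeg ▸ hd.pos)
  have hgle : g.natDegree ≤ d := hdeg ▸ Polynomial.natDegree_le_of_dvd hgdvd hP0
  rcases hgle.eq_or_lt with hgd | hgd
  · refine (Associated.irreducible_iff ?_).1 hg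
    exact Polynomial.associated_of_dvd_of_natDegree_le hgdvd hP0 (by rw [hdeg, hgd])
  · exfalso
    have : Fact (Irreducible g) := ⟨hg⟩
    have hfin : FiniteDimensional K (AdjoinRoot g) := (AdjoinRoot.powerBasis hg.ne_zero).finite
    refine aeval_ne_zero_of_line hy hxy (AdjoinRoot.root g) (h (AdjoinRoot g) ?_ _ ?_)
    · rw [finrank_adjoinRoot hg]
      exact (Nat.coprime_of_lt_prime hg.natDegree_pos.ne' hgd hd).symm
    · rw [← aeval_linePoly]
      exact aeval_root_eq_zero_of_dvd hgdvd

end Line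

section Norm

lemma Irreducible.norm_eval_one_le {K : Type*} [NontriviallyNormedField K] [IsUltrametricDist K]
    [CompleteSpace K] {P : Polynomial K} (hP : Irreducible P) :
    ‖P.eval 1‖ ≤ max ‖P.coeff 0‖ ‖P.leadingCoeff‖ := by
  have : Fact (Irreducible P) := ⟨hP⟩
  have hfin : FiniteDimensional K (AdjoinRoot P) := (AdjoinRoot.powerBasis hP.ne_zero).finite
  have hlc : P.leadingCoeff ≠ 0 := Polynomial.leadingCoeff_ne_zero.2 hP.ne_zero
  have hmin : minpoly K (AdjoinRoot.root P) = P * Polynomial.C P.leadingCoeff⁻¹ :=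
    AdjoinRoot.minpoly_root hP.ne_zero
  set Q := P * Polynomial.C P.leadingCoeff⁻¹ with hQ
  have hQmonic : Q.Monic := Polynomial.monic_mul_leadingCoeff_inv hP.ne_zero
  have hnorm := spectralNorm.spectralNorm_eq_norm_coeff_zero_rpow K (AdjoinRoot P)
    (AdjoinRoot.root P)
  rw [spectralNorm, hmin] at hnorm
  have hpos : 0 < Q.natDegree := by
    rw [← hmin]; exact minpoly.natDegree_pos (Algebra.IsIntegral.isIntegral _)
  have hcoeff : ∀ i, ‖Q.coeff i‖ ≤ max ‖Q.coeff 0‖ 1 := by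
    intro i
    rcases lt_trichotomy i Q.natDegree with hi | hi | hi
    · have h1 := le_ciSup (spectralValueTerms_bddAbove Q) i
      rw [← spectralValue, hnorm, spectralValueTerms_of_lt_natDegree Q hi] at h1
      set u := ‖Q.coeff 0‖ ^ (1 / Q.natDegree : ℝ) with hu
      have hu0 : 0 ≤ u := by positivity
      have huD : u ^ Q.natDegree = ‖Q.coeff 0‖ := by
        rw [hu, one_div, Real.rpow_inv_natCast_pow (norm_nonneg _) hpos.ne']
      have hcast : (Q.natDegree - i : ℝ) = ((Q.natDegree - i : ℕ) : ℝ) := by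
        rw [Nat.cast_sub hi.le]
      rw [hcast, one_div] at h1
      have h2 := pow_le_pow_left₀ (by positivity) h1 (Q.natDegree - i)
      rw [Real.rpow_inv_natCast_pow (norm_nonneg _) (Nat.sub_pos_of_lt hi).ne'] at h2
      refine h2.trans ?_
      rcases le_total u 1 with hu1 | hu1
      · exact (pow_le_one₀ hu0 hu1).trans (le_max_right _ _)
      · rw [← huD]
        exact (pow_le_pow_right₀ hu1 (Nat.sub_le _ _)).trans (le_max_left _ _)
    · rw [hi, hQmonic.coeff_natDegree, norm_one]
      exact le_max_right _ _
    · rw [Polynomial.coeff_eq_zero_of_natDegree_lt hi, norm_zero]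
      positivity
  have hQeval : ‖Q.eval 1‖ ≤ max ‖Q.coeff 0‖ 1 := by
    rw [Polynomial.eval_eq_sum_range]
    refine IsUltrametricDist.norm_sum_le_of_forall_le_of_nonneg (by positivity) fun i _ => ?_
    simpa using hcoeff i
  have hlc' : 0 < ‖P.leadingCoeff‖ := norm_pos_iff.2 hlc
  rw [hQ, Polynomial.eval_mul, Polynomial.eval_C, Polynomial.coeff_mul_C, norm_mul, norm_mul,
    norm_inv, ← div_eq_mul_inv, ← div_eq_mul_inv, div_le_iff₀ hlc', max_mul_of_nonneg _ _ hlc'.le,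
    div_mul_cancel₀ _ hlc'.ne', one_mul] at hQeval
  exact hQeval

variable {K : Type u} [NontriviallyNormedField K] {σ : Type*}

lemma NoCoprimeZero.norm_eval_add_le [IsUltrametricDist K] [CompleteSpace K] {d : ℕ} (hd : d.Prime)
    {f : MvPolynomial σ K} (hf : f.IsHomogeneous d) (h : NoCoprimeZero f d) (x y : σ → K) :
    ‖eval (x + y) f‖ ≤ max ‖eval x f‖ ‖eval y f‖ := by
  by_cases hy : y = 0
  · simp [hy]
  by_cases hxy : ∃ c : K, x = c • y
  · obtain ⟨c, rfl⟩ := hxy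
    have : c • y + y = (c + 1) • y := by rw [add_smul, one_smul]
    rw [this, eval_smul_of_isHomogeneous hf, eval_smul_of_isHomogeneous hf, norm_mul, norm_mul,
      norm_pow, norm_pow]
    have h1 : ‖c + 1‖ ^ d ≤ max (‖c‖ ^ d) 1 := by
      have := IsUltrametricDist.norm_add_le_max c 1
      rw [norm_one] at this
      refine (pow_le_pow_left₀ (norm_nonneg _) this d).trans ?_
      rcases max_cases ‖c‖ 1 with ⟨he, _⟩ | ⟨he, _⟩ <;> rw [he] <;> simp
    calc _ ≤ max (‖c‖ ^ d) 1 * ‖eval y f‖ := by gcongr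
      _ = _ := by rw [max_mul_of_nonneg _ _ (norm_nonneg _), one_mul]
  · push Not at hxy
    have hirr := h.irreducible_linePoly hd hf hy hxy
    have key := hirr.norm_eval_one_le
    obtain ⟨hle, hco⟩ := natDegree_linePoly_le_and_coeff hf x y
    have hc0 : (linePoly f x y).coeff d ≠ 0 := hco ▸ h.eval_ne_zero hy
    have hdeg : (linePoly f x y).natDegree = d :=
      le_antisymm hle (Polynomial.le_natDegree_of_ne_zero hc0)
    rwa [Polynomial.leadingCoeff, hdeg, hco, Polynomial.coeff_zero_eq_eval_zero, eval_linePoly,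
      eval_linePoly, one_smul, zero_smul, add_zero] at key

/-- By compactness, an anisotropic form over a locally compact field is proper. -/
lemma exists_pos_mul_norm_pow_le [ProperSpace K] [Fintype σ] {d : ℕ} (hd : d ≠ 0) {f : MvPolynomial σ K}
    (hf : f.IsHomogeneous d) (h : ∀ x : σ → K, x ≠ 0 → eval x f ≠ 0) :
    ∃ C : ℝ, 0 < C ∧ ∀ x : σ → K, C * ‖x‖ ^ d ≤ ‖eval x f‖ := by
  have hcont : Continuous fun x : σ → K => ‖eval x f‖ := (MvPolynomial.continuous_eval f).norm
  have hlow : ∃ C : ℝ, 0 < C ∧ ∀ x ∈ Metric.sphere (0 : σ → K) 1, C ≤ ‖eval x f‖ := by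
    rcases (Metric.sphere (0 : σ → K) 1).eq_empty_or_nonempty with he | hne
    · exact ⟨1, one_pos, by simp [he]⟩
    · obtain ⟨x₀, hx₀, hmin⟩ := (isCompact_sphere (0 : σ → K) 1).exists_isMinOn hne
        hcont.continuousOn
      refine ⟨‖eval x₀ f‖, norm_pos_iff.2 (h _ ?_), fun x hx => hmin hx⟩
      rintro rfl
      simp at hx₀
  obtain ⟨C, hC, hlow⟩ := hlow
  refine ⟨C, hC, fun x => ?_⟩
  by_cases hx : x = 0
  · simp [hx, hd]
  obtain ⟨i₀, -⟩ := Function.ne_iff.1 hx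
  have : Nonempty σ := ⟨i₀⟩
  obtain ⟨j, hj⟩ := Finite.exists_max fun i => ‖x i‖
  have hxj : ‖x j‖ = ‖x‖ :=
    le_antisymm (norm_le_pi_norm x j) ((pi_norm_le_iff_of_nonneg (norm_nonneg _)).2 hj)
  have hpos : 0 < ‖x‖ := norm_pos_iff.2 hx
  have h1 := hlow ((x j)⁻¹ • x) (by
    rw [mem_sphere_zero_iff_norm, norm_smul, norm_inv, hxj, inv_mul_cancel₀ hpos.ne'])
  rw [eval_smul_of_isHomogeneous hf, norm_mul, norm_pow, norm_inv, hxj, inv_pow] at h1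
  rwa [← le_div_iff₀ (by positivity), div_eq_inv_mul]
end Norm

section LocallyCompact

open scoped NormedField

variable {K : Type u} [NontriviallyNormedField K] [IsUltrametricDist K]

instance compactSpace_valuedInteger [ProperSpace K] : CompactSpace (Valued.integer K) := by
  refine isCompact_iff_compactSpace.1 ?_
  convert isCompact_closedBall (0 : K) 1
  ext x
  rw [SetLike.mem_coe, Valued.integer.mem_iff, mem_closedBall_zero_iff]

instance isNontrivial_valued_v : (Valued.v : Valuation K _).IsNontrivial := by
  obtain ⟨x, hx0, hx1⟩ := NormedField.exists_norm_lt_one K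
  refine (Valuation.isNontrivial_iff_exists_lt_one _).2 ⟨x, norm_pos_iff.1 hx0, ?_⟩
  exact hx1

instance finite_residueField_valuedInteger [ProperSpace K] :
    Finite (IsLocalRing.ResidueField (Valued.integer K)) :=
  let : (Valued.v : Valuation K _).RankOne :=
    { toRankLeOne := inferInstanceAs (NormedField.valuation (K := K)).RankLeOne
      toIsNontrivial := isNontrivial_valued_v }
  (Valued.integer.compactSpace_iff_completeSpace_and_isDiscreteValuationRing_and_finite_residueField.1
    inferInstance).2.2

lemma isDivisibleAt_iff_norm_le {σ : Type*} {f : MvPolynomial σ K} {z : Valued.integer K}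
    {x : σ → K} : IsDivisibleAt (Valued.integer K) f z x ↔ ‖eval x f‖ ≤ ‖(z : K)‖ := by
  constructor
  · rintro ⟨o, ho⟩
    rw [← ho, map_mul, norm_mul]
    exact mul_le_of_le_one_right (norm_nonneg _) (Valued.integer.mem_iff.1 o.2)
  · intro h
    by_cases hz : (z : K) = 0
    · refine ⟨0, ?_⟩
      rw [hz, norm_zero, norm_le_zero_iff] at h
      simp [h]
    · refine ⟨⟨eval x f / z, ?_⟩, ?_⟩
      · rw [Valued.integer.mem_iff, norm_div]
        exact div_le_one_of_le₀ h (norm_nonneg _)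
      · exact mul_div_cancel₀ _ hz

/-- Over a locally compact field whose residue field has at least `d` elements, a form of prime
degree `d` without nontrivial zeros over extensions of degree prime to `d` has at most `d ^ 2`
variables. -/
theorem NoCoprimeZero.card_le_sq_of_le_card_residueField [ProperSpace K] {σ : Type*} [Fintype σ]
    {d : ℕ} (hd : d.Prime)
    (hq : d ≤ Cardinal.mk (IsLocalRing.ResidueField (Valued.integer K)))
    {f : MvPolynomial σ K} (hf : f.IsHomogeneous d) (h : NoCoprimeZero f d) :
    Fintype.card σ ≤ d ^ 2 := by
  have hdvr : IsDiscreteValuationRing (Valued.integer K) :=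
    Valued.integer.isDiscreteValuationRing_of_compactSpace
  refine card_le_sq_of_isDivisibleAt_add (O := Valued.integer K) hd.ne_zero hq hf ?_ ?_
  · intro z x y hx hy
    rw [isDivisibleAt_iff_norm_le] at *
    exact (h.norm_eval_add_le hd hf x y).trans (max_le hx hy)
  · obtain ⟨C, hC, hle⟩ := exists_pos_mul_norm_pow_le hd.ne_zero hf fun x hx => h.eval_ne_zero hx
    obtain ⟨c, hc0, hc⟩ := NormedField.exists_norm_lt K (lt_min one_pos hC)
    rw [lt_min_iff] at hc
    refine ⟨⟨c, Valued.integer.mem_iff.2 hc.1.le⟩, ?_, fun x hx i => ?_⟩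
    · intro h0
      have : c = 0 := congrArg Subtype.val h0
      simp [this] at hc0
    · rw [isDivisibleAt_iff_norm_le] at hx
      refine ⟨⟨c * x i, ?_⟩, rfl⟩
      rw [Valued.integer.mem_iff, norm_mul]
      have h1 : C * ‖x‖ ^ d ≤ 1 := (hle x).trans (by simpa using hx)
      have h2 : (‖c‖ * ‖x‖) ^ d ≤ 1 := by
        calc (‖c‖ * ‖x‖) ^ d = ‖c‖ ^ d * ‖x‖ ^ d := mul_pow _ _ _
          _ ≤ C * ‖x‖ ^ d := by
            gcongr
            exact (pow_le_of_le_one (norm_nonneg _) hc.1.le hd.ne_zero).trans hc.2.le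
          _ ≤ 1 := h1
      refine le_trans ?_ ((pow_le_one_iff_of_nonneg (by positivity) hd.ne_zero).1 h2)
      gcongr
      exact norm_le_pi_norm x i

end LocallyCompact

section ResidueExtension

lemma exists_monic_irreducible_natDegree_eq (k : Type*) [Field k] [Finite k] {n : ℕ}
    (hn : n ≠ 0) : ∃ g : Polynomial k, g.Monic ∧ Irreducible g ∧ g.natDegree = n := by
  obtain ⟨p, _⟩ := CharP.exists k
  have : Fact p.Prime := ⟨CharP.char_is_prime k p⟩
  have : NeZero n := ⟨hn⟩
  obtain ⟨a, ha⟩ := Field.exists_primitive_element k (FiniteField.Extension k p n)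
  have hint : IsIntegral k a := Algebra.IsIntegral.isIntegral a
  exact ⟨minpoly k a, minpoly.monic hint, minpoly.irreducible hint, by
    rw [(Field.primitive_element_iff_minpoly_natDegree_eq k a).1 ha,
      FiniteField.finrank_extension]⟩

open scoped NormedField

lemma natDegree_le_card_residueField {K : Type*} [NontriviallyNormedField K] [IsUltrametricDist K]
    {L : Type*} [NontriviallyNormedField L] [IsUltrametricDist L] [NormedAlgebra K L]
    {G : Polynomial (Valued.integer K)} (hG : G.Monic)
    (hirr : Irreducible (G.map (IsLocalRing.residue _))) {θ : L}
    (hθ : Polynomial.aeval θ (G.map (algebraMap _ K)) = 0) :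
    G.natDegree ≤ Cardinal.mk (IsLocalRing.ResidueField (Valued.integer L)) := by
  let ι : Valued.integer K →+* Valued.integer L :=
    ((algebraMap K L).comp (algebraMap (Valued.integer K) K)).codRestrict (Valued.integer L)
      fun x => by
        rw [Valued.integer.mem_iff, RingHom.comp_apply, norm_algebraMap']
        exact Valued.integer.mem_iff.1 x.2
  have hι : ∀ x, (ι x : L) = algebraMap K L (x : K) := fun _ => rfl
  have hlocal : IsLocalHom ι := ⟨fun x hx => by
    rw [Valued.integer.isUnit_iff_norm_eq_one] at hx ⊢
    rw [← hx]
    change ‖(x : K)‖ = ‖(ι x : L)‖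
    rw [hι, norm_algebraMap']⟩
  have hroot : G.eval₂ ((algebraMap (Valued.integer L) L).comp ι) θ = 0 := by
    rwa [Polynomial.aeval_def, Polynomial.eval₂_map] at hθ
  have hθint : IsIntegral (Valued.integer L) θ :=
    ⟨G.map ι, hG.map ι, by rwa [Polynomial.eval₂_map]⟩
  have hmem : θ ∈ Valued.integer L :=
    (Valuation.integer.integers (Valued.v : Valuation L _)).mem_of_integral hθint
  let t : Valued.integer L := ⟨θ, hmem⟩
  have ht : G.eval₂ ι t = 0 := by
    refine Subtype.val_injective ?_
    change algebraMap (Valued.integer L) L _ = 0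
    rw [Polynomial.hom_eval₂]
    exact hroot
  have : Fact (Irreducible (G.map (IsLocalRing.residue _))) := ⟨hirr⟩
  let φ : AdjoinRoot (G.map (IsLocalRing.residue _)) →+*
      IsLocalRing.ResidueField (Valued.integer L) :=
    AdjoinRoot.lift (IsLocalRing.ResidueField.map ι) (IsLocalRing.residue _ t) (by
      rw [Polynomial.eval₂_map, IsLocalRing.ResidueField.map_comp_residue,
        ← Polynomial.hom_eval₂, ht, map_zero])
  let b := AdjoinRoot.powerBasis hirr.ne_zero
  have hdim : b.dim = G.natDegree := by
    rw [AdjoinRoot.powerBasis_dim, hG.natDegree_map]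
  have := Cardinal.lift_mk_le_lift_mk_of_injective (φ.injective.comp b.basis.injective)
  simpa [hdim] using this

section SpectralNorm

variable (K : Type*) [NontriviallyNormedField K] [IsUltrametricDist K] (L : Type*) [Field L]
  [Algebra K L] [FiniteDimensional K L]

lemma spectralNorm.isUltrametricDist [CompleteSpace K] :
    letI := spectralNorm.nontriviallyNormedField K L
    IsUltrametricDist L :=
  letI := spectralNorm.nontriviallyNormedField K L
  IsUltrametricDist.isUltrametricDist_of_isNonarchimedean_norm isNonarchimedean_spectralNorm

lemma spectralNorm.properSpace [ProperSpace K] :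
    letI := spectralNorm.nontriviallyNormedField K L
    ProperSpace L :=
  letI := spectralNorm.nontriviallyNormedField K L
  letI := spectralNorm.normedAlgebra K L
  FiniteDimensional.proper K L

end SpectralNorm

lemma NoCoprimeZero.map {K : Type u} [Field K] {σ : Type*} {f : MvPolynomial σ K} {d : ℕ}
    (h : NoCoprimeZero f d) (L : Type u) [Field L] [Algebra K L] [FiniteDimensional K L]
    (hL : (Module.finrank K L).Coprime d) : NoCoprimeZero (map (algebraMap K L) f) d := by
  intro M _ _ _ hM x hx
  let : Algebra K M := ((algebraMap L M).comp (algebraMap K L)).toAlgebra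
  have : IsScalarTower K L M := IsScalarTower.of_algebraMap_eq' rfl
  have : FiniteDimensional K M := FiniteDimensional.trans K L M
  refine h M ?_ x ?_
  · rw [← Module.finrank_mul_finrank K L M]
    exact hL.mul_left hM
  · rwa [aeval_map_algebraMap] at hx

/-- A form of prime degree `d` over a locally compact nonarchimedean field without nontrivial
zeros over extensions of degree prime to `d` has at most `d ^ 2` variables. -/
theorem NoCoprimeZero.card_le_sq {K : Type u} [NontriviallyNormedField K] [IsUltrametricDist K]
    [ProperSpace K] {σ : Type*} [Fintype σ] {d : ℕ} (hd : d.Prime) {f : MvPolynomial σ K}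
    (hf : f.IsHomogeneous d) (h : NoCoprimeZero f d) : Fintype.card σ ≤ d ^ 2 := by
  obtain ⟨g, hgm, hgirr, hgdeg⟩ := exists_monic_irreducible_natDegree_eq
    (IsLocalRing.ResidueField (Valued.integer K)) d.succ_ne_zero
  obtain ⟨G, hGg, hGdeg, hGm⟩ := Polynomial.lifts_and_natDegree_eq_and_monic
    ((Polynomial.mem_lifts _).2 (Polynomial.map_surjective _ IsLocalRing.residue_surjective g)) hgm
  rw [← hGg] at hgirr
  set P := G.map (algebraMap (Valued.integer K) K) with hP
  have hPirr : Irreducible P :=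
    hGm.irreducible_iff_irreducible_map_fraction_map.1
      (hGm.irreducible_of_irreducible_map _ _ hgirr)
  have : Fact (Irreducible P) := ⟨hPirr⟩
  have hPdeg : P.natDegree = d + 1 := by rw [hP, hGm.natDegree_map, hGdeg, hgdeg]
  have hfin : FiniteDimensional K (AdjoinRoot P) := (AdjoinRoot.powerBasis hPirr.ne_zero).finite
  have hrank : Module.finrank K (AdjoinRoot P) = d + 1 := by
    rw [finrank_adjoinRoot hPirr, hPdeg]
  have hL := h.map (AdjoinRoot P) (by rw [hrank]; simp)
  have hroot := aeval_root_eq_zero_of_dvd (dvd_refl P)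
  let := spectralNorm.nontriviallyNormedField K (AdjoinRoot P)
  let := spectralNorm.normedAlgebra K (AdjoinRoot P)
  have := spectralNorm.isUltrametricDist K (AdjoinRoot P)
  have := spectralNorm.properSpace K (AdjoinRoot P)
  have hcard := natDegree_le_card_residueField hGm hgirr hroot
  refine hL.card_le_sq_of_le_card_residueField hd (le_trans ?_ hcard) (hf.map _)
  rw [hGdeg, hgdeg]
  exact_mod_cast d.le_succ

end ResidueExtension

section ClosedPoints

lemma dvd_natDegree_of_forall_irreducible_dvd {K : Type*} [Field K] {k : ℕ} (P : Polynomial K)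
    (h : ∀ g, Irreducible g → g ∣ P → k ∣ g.natDegree) : k ∣ P.natDegree := by
  induction P using WfDvdMonoid.induction_on_irreducible with
  | zero => simp
  | unit u hu => simp [Polynomial.natDegree_eq_zero_of_isUnit hu]
  | mul a i ha hi ih =>
    rw [Polynomial.natDegree_mul hi.ne_zero ha]
    exact dvd_add (h i hi (dvd_mul_right _ _)) (ih fun g hg hga => h g hg (hga.mul_left _))

variable {K : Type u} [Field K] {σ : Type*}

/-- `m` is the degree of a finite extension of `K` inside `AlgebraicClosure K` over which `f` has
a nontrivial zero. -/
def IsZeroDegree (f : MvPolynomial σ K) (m : ℕ) : Prop :=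
  ∃ M : IntermediateField K (AlgebraicClosure K), FiniteDimensional K M ∧
    (∃ x : σ → M, x ≠ 0 ∧ eval x (map (algebraMap K M) f) = 0) ∧ Module.finrank K M = m

lemma isZeroDegree_of_aeval_eq_zero {f : MvPolynomial σ K} {L : Type*} [Field L] [Algebra K L]
    [FiniteDimensional K L] {x : σ → L} (hx : x ≠ 0) (h : aeval x f = 0) :
    IsZeroDegree f (Module.finrank K L) := by
  let φ : L →ₐ[K] AlgebraicClosure K := IsAlgClosed.lift
  let e : L ≃ₐ[K] φ.fieldRange := AlgEquiv.ofInjectiveField φ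
  refine ⟨φ.fieldRange, e.toLinearEquiv.finiteDimensional, ⟨fun i => e (x i), ?_, ?_⟩,
    e.toLinearEquiv.finrank_eq.symm⟩
  · intro h0
    refine hx (funext fun i => e.injective ?_)
    simpa using congrFun h0 i
  · have := congrArg e h
    rw [map_zero] at this
    rw [eval_map, ← aeval_def, ← this]
    exact ((comp_aeval_apply x (e : L →ₐ[K] φ.fieldRange) f)).symm

/-- A nontrivial zero over an extension of degree prime to the prime degree of `f` yields a
`0`-cycle of degree `1`, after adding the zeros of `f` on a line. -/
lemma IsZeroDegree.eq_one_of_forall_dvd [Nontrivial σ] {d : ℕ} {f : MvPolynomial σ K}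
    (hf : f.IsHomogeneous d) {m : ℕ} (hm : IsZeroDegree f m) (hmd : m.Coprime d) {k : ℕ}
    (hk : ∀ l, l ≤ max 1 (max m d) → IsZeroDegree f l → k ∣ l) : k = 1 := by
  classical
  obtain ⟨i, j, hij⟩ := exists_pair_ne σ
  let x : σ → K := Pi.single i 1
  let y : σ → K := Pi.single j 1
  have hy : y ≠ 0 := by simp [y]
  have hxy : ∀ c : K, x ≠ c • y := fun c hc => by
    have := congrFun hc i
    simp [x, y, hij] at this
  by_cases hyf : eval y f = 0
  · have h1 : IsZeroDegree f (Module.finrank K K) :=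
      isZeroDegree_of_aeval_eq_zero hy (by rw [aeval_eq_eval]; exact hyf)
    rw [Module.finrank_self] at h1
    exact Nat.dvd_one.1 (hk 1 (le_max_left _ _) h1)
  obtain ⟨hle, hco⟩ := natDegree_linePoly_le_and_coeff hf x y
  have hdeg : (linePoly f x y).natDegree = d :=
    le_antisymm hle (Polynomial.le_natDegree_of_ne_zero (hco ▸ hyf))
  have hP0 : linePoly f x y ≠ 0 := by
    intro h0
    rw [h0, Polynomial.coeff_zero] at hco
    exact hyf hco.symm
  have hkd : k ∣ d := by
    rw [← hdeg]
    refine dvd_natDegree_of_forall_irreducible_dvd _ fun g hg hgdvd => ?_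
    have hgle : g.natDegree ≤ d := hdeg ▸ Polynomial.natDegree_le_of_dvd hgdvd hP0
    refine hk _ (hgle.trans ((le_max_right _ _).trans (le_max_right _ _))) ?_
    have : Fact (Irreducible g) := ⟨hg⟩
    have hfin : FiniteDimensional K (AdjoinRoot g) := (AdjoinRoot.powerBasis hg.ne_zero).finite
    rw [← finrank_adjoinRoot hg]
    refine isZeroDegree_of_aeval_eq_zero (aeval_ne_zero_of_line hy hxy (AdjoinRoot.root g)) ?_
    rw [← aeval_linePoly]
    exact aeval_root_eq_zero_of_dvd hgdvd
  exact Nat.eq_one_of_dvd_coprimes hmd (hk m ((le_max_left _ _).trans (le_max_right _ _)) hm) hkd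

end ClosedPoints

/-- **Kato–Kuzumaki**. Let `K` be a `p`-adic field, `d` a prime number, and `f` a
homogeneous polynomial of degree `d` in `n+1` variables over `K` with `n ≥ d²`. Then the
hypersurface `{f = 0}` carries a `0`-cycle of degree `1`: there are finitely many finite
field extensions `L j` of `K` (inside an algebraic closure of `K`) over each of which `f`
acquires a nontrivial zero, with the gcd of the degrees `[L j : K]` equal to `1`. -/
theorem kato_kuzumaki (p : ℕ) [Fact p.Prime]
    (K : Type*) [Field K] [Algebra ℚ_[p] K] [FiniteDimensional ℚ_[p] K]
    (d : ℕ) (hd : d.Prime) (n : ℕ) (hn : d ^ 2 ≤ n)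
    (f : MvPolynomial (Fin (n + 1)) K) (hf : f.IsHomogeneous d) :
    ∃ (r : ℕ) (L : Fin r → IntermediateField K (AlgebraicClosure K)),
      (∀ j, FiniteDimensional K (L j)) ∧
      (∀ j, ∃ x : Fin (n + 1) → L j, x ≠ 0 ∧
        MvPolynomial.eval x (MvPolynomial.map (algebraMap K (L j)) f) = 0) ∧
      Finset.univ.gcd (fun j => Module.finrank K (L j)) = 1 := by
  classical
  have hzero : ¬ NoCoprimeZero f d := by
    intro h
    let := spectralNorm.nontriviallyNormedField ℚ_[p] K
    have := spectralNorm.isUltrametricDist ℚ_[p] K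
    have := spectralNorm.properSpace ℚ_[p] K
    have hcard := NoCoprimeZero.card_le_sq hd hf h
    rw [Fintype.card_fin] at hcard
    omega
  simp only [NoCoprimeZero, not_forall] at hzero
  obtain ⟨L, _, _, _, hcop, x, hx0, hx⟩ := hzero
  have hm : IsZeroDegree f (Module.finrank K L) := isZeroDegree_of_aeval_eq_zero hx hx0
  have : NeZero n := ⟨((pow_pos hd.pos 2).trans_le hn).ne'⟩
  have : Nontrivial (Fin (n + 1)) := Fin.nontrivial_iff_two_le.2 (by have := NeZero.pos n; omega)
  set S : Finset ℕ :=
    (Finset.range (max 1 (max (Module.finrank K L) d) + 1)).filter (IsZeroDegree f) with hS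
  have hmem : ∀ j : Fin S.card, IsZeroDegree f (S.equivFin.symm j : ℕ) := fun j =>
    (Finset.mem_filter.1 (S.equivFin.symm j).2).2
  choose M hM hMx hMrank using hmem
  refine ⟨S.card, M, hM, hMx, hm.eq_one_of_forall_dvd hf hcop fun l hl hlf => ?_⟩
  have hlS : l ∈ S := Finset.mem_filter.2 ⟨Finset.mem_range.2 (Nat.lt_succ_of_le hl), hlf⟩
  have := Finset.gcd_dvd (f := fun j => Module.finrank K (M j))
    (Finset.mem_univ (S.equivFin ⟨l, hlS⟩))
  simpa [hMrank] using this
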